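/- The Dirac operator D̸ on F × F (a linear endomorphism of a 24-dimensional complex vector space) is diagonalizable with spectrum {0, 3, −3}, and each of the three eigenspaces, for eigenvalue 0, eigenvalue 3, and eigenvalue −3, has dimension exactly 8; in particular F × F is the direct sum of these three eigenspaces. -/

import Mathlib

noncomputable section
open DihedralGroup Complex

abbrev D6 := DihedralGroup 6
/-- the reflection `s` -/
def s : D6 := DihedralGroup.sr 0
/-- the rotation `r` of order 6 -/
def rot : D6 := DihedralGroup.r 1
/-- `t = s*r` -/
def t : D6 := s * rot
/-- `x = s*r^3` -/
def x : D6 := s * rot ^ 3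
/-- `y = s*r^5` -/
def y : D6 := s * rot ^ 5
/-- `F` is the space of complex-valued functions on `D₆`. -/
abbrev F := D6 → ℂ

/-- The right-translation operator `(R_a f)(g) = f(g·a)`. -/
def R (a : D6) : Module.End ℂ F := LinearMap.funLeft ℂ ℂ (fun g => g * a)

/-- `ω = exp(iπ/3)`. -/
def ω : ℂ := Complex.exp (Real.pi * Complex.I / 3)

/-- `D₀ = R_t + R_x + R_y`. -/
def D₀ : Module.End ℂ F := R t + R x + R y

/-- `D₁ = ω·R_t + ω³·R_x + ω⁵·R_y`. -/
def D₁ : Module.End ℂ F := ω • R t + ω ^ 3 • R x + ω ^ 5 • R y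

/-- `D₂ = ω⁻¹·R_t + ω⁻³·R_x + ω⁻⁵·R_y`. -/
def D₂ : Module.End ℂ F := ω⁻¹ • R t + (ω ^ 3)⁻¹ • R x + (ω ^ 5)⁻¹ • R y

/-- The Dirac operator `D̸(f₁, f₂) = (−D₀f₁ + D₂f₂, D₁f₁ − D₀f₂)` on `F × F`. -/
def Dir : Module.End ℂ (F × F) :=
  LinearMap.prod (D₂ ∘ₗ LinearMap.snd ℂ F F - D₀ ∘ₗ LinearMap.fst ℂ F F)
    (D₁ ∘ₗ LinearMap.fst ℂ F F - D₀ ∘ₗ LinearMap.snd ℂ F F)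

theorem omega_sq : ω ^ 2 = ω - 1 := by
  have h : ω = 1 / 2 + (Real.sqrt 3 / 2 : ℝ) * I := by
    have h3 : (Real.pi * I / 3 : ℂ) = ((Real.pi / 3 : ℝ) : ℂ) * I := by push_cast; ring
    rw [ω, h3, exp_mul_I, ← ofReal_cos, ← ofReal_sin, Real.cos_pi_div_three,
      Real.sin_pi_div_three]
    push_cast; ring
  have h3 : ((Real.sqrt 3 : ℝ) : ℂ) ^ 2 = 3 := by
    rw [← ofReal_pow, Real.sq_sqrt (by norm_num)]; norm_num
  rw [h]; push_cast
  linear_combination (I ^ 2 / 4) * h3 + (3 / 4 : ℂ) * I_sq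

theorem omega_pow_three : ω ^ 3 = -1 := by
  linear_combination (ω + 1) * omega_sq

theorem omega_pow_five : ω ^ 5 = 1 - ω := by
  linear_combination ω ^ 2 * omega_pow_three - omega_sq

theorem omega_inv : ω⁻¹ = 1 - ω :=
  inv_eq_of_mul_eq_one_right (by linear_combination -omega_sq)

theorem omega_pow_five_inv : (ω ^ 5)⁻¹ = ω := by
  rw [omega_pow_five, ← omega_inv, inv_inv]

theorem Dir_fst_apply (f : F × F) (g : D6) :
    (Dir f).1 g = (1 - ω) * f.2 (g * sr 1) - f.2 (g * sr 3) + ω * f.2 (g * sr 5)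
      - (f.1 (g * sr 1) + f.1 (g * sr 3) + f.1 (g * sr 5)) := by
  simp [Dir, D₀, D₂, R, t, x, y, s, rot, omega_inv, omega_pow_three, omega_pow_five_inv,
    LinearMap.funLeft]
  ring

theorem Dir_snd_apply (f : F × F) (g : D6) :
    (Dir f).2 g = ω * f.1 (g * sr 1) - f.1 (g * sr 3) + (1 - ω) * f.1 (g * sr 5)
      - (f.2 (g * sr 1) + f.2 (g * sr 3) + f.2 (g * sr 5)) := by
  simp [Dir, D₀, D₁, R, t, x, y, s, rot, omega_pow_three, omega_pow_five,
    LinearMap.funLeft]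
  ring

theorem sr_mul_products :
    (sr 1 * sr 1 : D6) = 1 ∧ (sr 3 * sr 3 : D6) = 1 ∧ (sr 5 * sr 5 : D6) = 1 ∧
    (sr 1 * sr 3 : D6) = r 2 ∧ (sr 3 * sr 5 : D6) = r 2 ∧ (sr 5 * sr 1 : D6) = r 2 ∧
    (sr 3 * sr 1 : D6) = r 4 ∧ (sr 5 * sr 3 : D6) = r 4 ∧ (sr 1 * sr 5 : D6) = r 4 ∧
    (r 2 * sr 1 : D6) = sr 5 ∧ (r 2 * sr 3 : D6) = sr 1 ∧ (r 2 * sr 5 : D6) = sr 3 ∧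
    (r 4 * sr 1 : D6) = sr 3 ∧ (r 4 * sr 3 : D6) = sr 5 ∧ (r 4 * sr 5 : D6) = sr 1 := by
  decide

theorem Dir_cube (f : F × F) : Dir (Dir (Dir f)) = (9 : ℂ) • Dir f := by
  obtain ⟨h1, h2, h3, h4, h5, h6, h7, h8, h9, h10, h11, h12, h13, h14, h15⟩ := sr_mul_products
  ext g
  · simp only [Dir_fst_apply, Dir_snd_apply, Prod.smul_fst, Pi.smul_apply, smul_eq_mul,
      mul_assoc g, h1, h2, h3, h4, h5, h6, h7, h8, h9, h10, h11, h12, h13, h14, h15, one_mul]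
    have := omega_sq
    grind
  · simp only [Dir_fst_apply, Dir_snd_apply, Prod.smul_snd, Pi.smul_apply, smul_eq_mul,
      mul_assoc g, h1, h2, h3, h4, h5, h6, h7, h8, h9, h10, h11, h12, h13, h14, h15, one_mul]
    have := omega_sq
    grind

theorem trace_prod_pi {ι : Type*} [Fintype ι] [DecidableEq ι]
    (A : Module.End ℂ ((ι → ℂ) × (ι → ℂ))) :
    LinearMap.trace ℂ _ A =
      ∑ i, (A (Pi.single i 1, 0)).1 i + ∑ i, (A (0, Pi.single i 1)).2 i := by
  rw [LinearMap.trace_eq_matrix_trace ℂ ((Pi.basisFun ℂ ι).prod (Pi.basisFun ℂ ι))]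
  simp [Matrix.trace, LinearMap.toMatrix_apply]

theorem trace_Dir : LinearMap.trace ℂ _ Dir = 0 := by
  have h (g : D6) : g * sr 1 ≠ g ∧ g * sr 3 ≠ g ∧ g * sr 5 ≠ g := by
    revert g; decide
  rw [trace_prod_pi]
  simp [Dir_fst_apply, Dir_snd_apply, -mul_eq_left, h]

theorem trace_Dir_sq : LinearMap.trace ℂ _ (Dir ∘ₗ Dir) = 144 := by
  obtain ⟨h1, h2, h3, h4, h5, h6, h7, h8, h9, -⟩ := sr_mul_products
  have h (g : D6) : g * r 2 ≠ g ∧ g * r 4 ≠ g := by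
    revert g; decide
  rw [trace_prod_pi]
  simp only [LinearMap.comp_apply, Dir_fst_apply, Dir_snd_apply, Pi.single_apply, mul_assoc,
    h1, h2, h3, h4, h5, h6, h7, h8, h9, h, mul_one, Pi.zero_apply, if_true, if_false,
    Finset.sum_const, Finset.card_univ, DihedralGroup.card, nsmul_eq_mul]
  push_cast
  linear_combination (-48 : ℂ) * omega_sq

section CubicOperator

variable {V : Type*} [AddCommGroup V] [Module ℂ V] {A : Module.End ℂ V}

theorem isProj_eigenspace_zero (hA : ∀ v, A (A (A v)) = (9 : ℂ) • A v) :
    LinearMap.IsProj (A.eigenspace 0) (LinearMap.id - (1 / 9 : ℂ) • (A ∘ₗ A)) where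
  map_mem v := by
    rw [Module.End.mem_eigenspace_iff]
    simp only [LinearMap.sub_apply, LinearMap.id_apply, LinearMap.smul_apply,
      LinearMap.comp_apply, map_sub, map_smul, hA]
    module
  map_id v hv := by
    rw [Module.End.mem_eigenspace_iff] at hv
    simp [hv]

theorem isProj_eigenspace_of_sq_eq_nine (hA : ∀ v, A (A (A v)) = (9 : ℂ) • A v) {μ : ℂ}
    (hμ : μ ^ 2 = 9) :
    LinearMap.IsProj (A.eigenspace μ) ((1 / 18 : ℂ) • (A ∘ₗ A + μ • A)) where
  map_mem v := by
    rw [Module.End.mem_eigenspace_iff]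
    simp only [LinearMap.add_apply, LinearMap.smul_apply,
      LinearMap.comp_apply, map_add, map_smul, hA, ← hμ]
    module
  map_id v hv := by
    rw [Module.End.mem_eigenspace_iff] at hv
    simp only [LinearMap.add_apply, LinearMap.smul_apply, LinearMap.comp_apply, map_smul, hv,
      smul_smul, ← add_smul]
    rw [show 1 / 18 * (μ * μ + μ * μ) = 1 by linear_combination hμ / 9, one_smul]

theorem sup_eigenspaces_eq_top (hA : ∀ v, A (A (A v)) = (9 : ℂ) • A v) :
    A.eigenspace 0 ⊔ A.eigenspace 3 ⊔ A.eigenspace (-3) = ⊤ := by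
  refine eq_top_iff.2 fun v _ => ?_
  have h0 := (isProj_eigenspace_zero hA).map_mem v
  have h3 := (isProj_eigenspace_of_sq_eq_nine hA (μ := 3) (by norm_num)).map_mem v
  have h3' := (isProj_eigenspace_of_sq_eq_nine hA (μ := -3) (by norm_num)).map_mem v
  convert Submodule.add_mem_sup (Submodule.add_mem_sup h0 h3) h3' using 1
  simp only [LinearMap.sub_apply, LinearMap.id_apply, LinearMap.smul_apply,
    LinearMap.add_apply, LinearMap.comp_apply]
  module

theorem mem_of_hasEigenvalue (hA : ∀ v, A (A (A v)) = (9 : ℂ) • A v) {μ : ℂ}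
    (hμ : A.HasEigenvalue μ) : μ ∈ ({0, 3, -3} : Set ℂ) := by
  obtain ⟨v, hv⟩ := hμ.exists_hasEigenvector
  have h := hA v
  simp only [hv.apply_eq_smul, map_smul, smul_smul] at h
  have h' : μ * ((μ - 3) * (μ + 3)) = 0 := by
    linear_combination smul_left_injective ℂ hv.2 h
  simpa [sub_eq_zero, add_eq_zero_iff_eq_neg] using h'

end CubicOperator

theorem finrank_eigenspace_Dir_zero : Module.finrank ℂ (Dir.eigenspace 0) = 8 := by
  have h := (isProj_eigenspace_zero Dir_cube).trace
  simp only [map_sub, map_smul, trace_Dir_sq, LinearMap.trace_id, Module.finrank_prod,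
    Module.finrank_fintype_fun_eq_card, DihedralGroup.card] at h
  norm_num at h
  exact_mod_cast h.symm

theorem finrank_eigenspace_Dir {μ : ℂ} (hμ : μ ^ 2 = 9) :
    Module.finrank ℂ (Dir.eigenspace μ) = 8 := by
  have h := (isProj_eigenspace_of_sq_eq_nine Dir_cube hμ).trace
  simp only [map_add, map_smul, trace_Dir_sq, trace_Dir] at h
  norm_num at h
  exact_mod_cast h.symm

theorem hasEigenvalue_Dir_of_finrank {μ : ℂ} (h : Module.finrank ℂ (Dir.eigenspace μ) = 8) :
    Dir.HasEigenvalue μ := by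
  rw [Module.End.hasEigenvalue_iff]
  intro hbot
  rw [hbot, finrank_bot] at h
  norm_num at h

/-- The Dirac operator `D̸` on the 24-dimensional space `F × F` is diagonalizable with
spectrum `{0, 3, −3}`, each eigenspace has dimension exactly 8, and `F × F` is the
direct sum of the three eigenspaces. -/
theorem dirac_diagonalizable :
    Module.finrank ℂ (F × F) = 24 ∧
    (⨆ μ : ℂ, Module.End.eigenspace Dir μ) = ⊤ ∧
    {μ : ℂ | Module.End.HasEigenvalue Dir μ} = {0, 3, -3} ∧
    Module.finrank ℂ ↥(Module.End.eigenspace Dir 0) = 8 ∧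
    Module.finrank ℂ ↥(Module.End.eigenspace Dir 3) = 8 ∧
    Module.finrank ℂ ↥(Module.End.eigenspace Dir (-3)) = 8 ∧
    Module.End.eigenspace Dir 0 ⊔ Module.End.eigenspace Dir 3 ⊔ Module.End.eigenspace Dir (-3)
      = ⊤ := by
  have h0 := finrank_eigenspace_Dir_zero
  have h3 := finrank_eigenspace_Dir (μ := 3) (by norm_num)
  have h3' := finrank_eigenspace_Dir (μ := -3) (by norm_num)
  have htop := sup_eigenspaces_eq_top Dir_cube
  refine ⟨?_, ?_, ?_, h0, h3, h3', htop⟩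
  · simp [DihedralGroup.card]
  · refine eq_top_iff.2 (htop.symm.le.trans ?_)
    exact sup_le (sup_le (le_iSup _ 0) (le_iSup _ 3)) (le_iSup _ (-3))
  · refine Set.Subset.antisymm (fun μ hμ => mem_of_hasEigenvalue Dir_cube hμ) ?_
    rintro μ (rfl | rfl | rfl)
    exacts [hasEigenvalue_Dir_of_finrank h0, hasEigenvalue_Dir_of_finrank h3,
      hasEigenvalue_Dir_of_finrank h3']
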